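/- Let h ≥ 0, 0 ≤ k ≤ m, 0 ≤ s ≤ m−h, s+h ≤ n. Let V = ⟨e_1,…,e_s⟩, V' = ⟨e_1,…,e_{s+h}⟩ ⊆ F_q^n, U = ⟨e_1,…,e_k⟩ ⊆ F_q^m, and C = Mat(V) + (Mat(U)^t ∩ Mat(V')) ⊆ F_q^{n×m}. Then for every subspace K ⊆ F_q^m: dim(C) − dim(C ∩ Mat(K^⊥)^t) = h·(k − dim(U ∩ K^⊥)) + s·dim(K); equivalently, the row rank function satisfies ρ_r(C,K) = (h(k − dim(U ∩ K^⊥)) + s·dim(K))/n. -/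

import Mathlib

open Matrix

/-- The maximum rank of a rank-metric code (an `𝔽`-linear subspace of `n × m` matrices). -/
noncomputable def maxrk {𝔽 : Type*} [Field 𝔽] {n m : ℕ}
    (C : Submodule 𝔽 (Matrix (Fin n) (Fin m) 𝔽)) : ℕ :=
  sSup (Matrix.rank '' (C : Set (Matrix (Fin n) (Fin m) 𝔽)))

/-- The dual code with respect to the trace bilinear form `⟨M, N⟩ = Tr(M Nᵗ)`. -/
def dualCode {𝔽 : Type*} [Field 𝔽] {n m : ℕ}
    (C : Submodule 𝔽 (Matrix (Fin n) (Fin m) 𝔽)) :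
    Submodule 𝔽 (Matrix (Fin n) (Fin m) 𝔽) where
  carrier := {M | ∀ N ∈ C, Matrix.trace (M * Nᵀ) = 0}
  add_mem' := by
    intro a b ha hb N hN
    show Matrix.trace ((a + b) * Nᵀ) = 0
    rw [Matrix.add_mul, Matrix.trace_add, ha N hN, hb N hN, add_zero]
  zero_mem' := by
    intro N hN
    simp
  smul_mem' := by
    intro c a ha N hN
    show Matrix.trace ((c • a) * Nᵀ) = 0
    rw [Matrix.smul_mul, Matrix.trace_smul, ha N hN, smul_zero]

/-- `C` is an optimal anticode if `dim C = m * maxrk C`. -/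
def isOptAnticode {𝔽 : Type*} [Field 𝔽] {n m : ℕ}
    (C : Submodule 𝔽 (Matrix (Fin n) (Fin m) 𝔽)) : Prop :=
  Module.finrank 𝔽 C = m * maxrk C

/-- `C` is a quasi optimal anticode if `m ∤ dim C` and `maxrk C = ⌈dim C / m⌉`. -/
def isQOAC {𝔽 : Type*} [Field 𝔽] {n m : ℕ}
    (C : Submodule 𝔽 (Matrix (Fin n) (Fin m) 𝔽)) : Prop :=
  ¬ (m ∣ Module.finrank 𝔽 C) ∧
    (maxrk C : ℤ) = ⌈(Module.finrank 𝔽 C : ℚ) / (m : ℚ)⌉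

/-- `C` is a dually quasi optimal anticode if both `C` and `C^⊥` are qOACs. -/
def isDuallyQOAC {𝔽 : Type*} [Field 𝔽] {n m : ℕ}
    (C : Submodule 𝔽 (Matrix (Fin n) (Fin m) 𝔽)) : Prop :=
  isQOAC C ∧ isQOAC (dualCode C)

/-- The code of matrices vanishing at all positions `(i, j)` with `¬ P i j`. -/
def zeroOutside {𝔽 : Type*} [Field 𝔽] {n m : ℕ} (P : Fin n → Fin m → Prop) :
    Submodule 𝔽 (Matrix (Fin n) (Fin m) 𝔽) where
  carrier := {M | ∀ i j, ¬ P i j → M i j = 0}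
  add_mem' := by
    intro a b ha hb i j h
    simp [Matrix.add_apply, ha i j h, hb i j h]
  zero_mem' := by
    intro i j h
    simp
  smul_mem' := by
    intro c a ha i j h
    simp [Matrix.smul_apply, ha i j h]

/-- `Mat(V)`: the matrices all of whose columns lie in `V ⊆ 𝔽^n`. -/
def matCol {𝔽 : Type*} [Field 𝔽] {n m : ℕ} (V : Submodule 𝔽 (Fin n → 𝔽)) :
    Submodule 𝔽 (Matrix (Fin n) (Fin m) 𝔽) where
  carrier := {M | ∀ j, (fun i => M i j) ∈ V}
  add_mem' := by
    intro a b ha hb j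
    exact V.add_mem (ha j) (hb j)
  zero_mem' := by
    intro j
    exact V.zero_mem
  smul_mem' := by
    intro c a ha j
    exact V.smul_mem c (ha j)

/-- `Mat(U)ᵗ`: the matrices all of whose rows lie in `U ⊆ 𝔽^m`. -/
def matRow {𝔽 : Type*} [Field 𝔽] {n m : ℕ} (U : Submodule 𝔽 (Fin m → 𝔽)) :
    Submodule 𝔽 (Matrix (Fin n) (Fin m) 𝔽) where
  carrier := {M | ∀ i, M i ∈ U}
  add_mem' := by
    intro a b ha hb i
    exact U.add_mem (ha i) (hb i)
  zero_mem' := by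
    intro i
    exact U.zero_mem
  smul_mem' := by
    intro c a ha i
    exact U.smul_mem c (ha i)

/-- `⟨e_1, …, e_s⟩ ⊆ 𝔽^ℓ`: the span of the first `s` canonical basis vectors. -/
def spanFirst (𝔽 : Type*) [Field 𝔽] (ℓ s : ℕ) : Submodule 𝔽 (Fin ℓ → 𝔽) :=
  Submodule.span 𝔽 ((fun i : Fin ℓ => Pi.single i (1 : 𝔽)) '' {i : Fin ℓ | (i : ℕ) < s})

/-- Orthogonal complement with respect to the standard dot product on `𝔽^ℓ`. -/
def perp {𝔽 : Type*} [Field 𝔽] {ℓ : ℕ} (W : Submodule 𝔽 (Fin ℓ → 𝔽)) :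
    Submodule 𝔽 (Fin ℓ → 𝔽) where
  carrier := {v | ∀ w ∈ W, ∑ i, v i * w i = 0}
  add_mem' := by
    intro a b ha hb w hw
    simp [add_mul, Finset.sum_add_distrib, ha w hw, hb w hw]
  zero_mem' := by
    intro w hw
    simp
  smul_mem' := by
    intro c a ha w hw
    simp [mul_assoc, ← Finset.mul_sum, ha w hw]

/-- Equivalence of rank-metric codes: `C = {N A M : A ∈ D}` for invertible `N, M`, or
(when `n = m`) `C = {N Aᵗ M : A ∈ D}` for invertible `N, M`. -/
def equivCode {𝔽 : Type*} [Field 𝔽] {n m : ℕ}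
    (C D : Submodule 𝔽 (Matrix (Fin n) (Fin m) 𝔽)) : Prop :=
  (∃ (N : Matrix (Fin n) (Fin n) 𝔽) (M : Matrix (Fin m) (Fin m) 𝔽),
      IsUnit N ∧ IsUnit M ∧
      (C : Set (Matrix (Fin n) (Fin m) 𝔽)) = (fun A : Matrix (Fin n) (Fin m) 𝔽 => N * A * M) '' (D : Set (Matrix (Fin n) (Fin m) 𝔽))) ∨
  (∃ (h : n = m) (N : Matrix (Fin n) (Fin n) 𝔽) (M : Matrix (Fin m) (Fin m) 𝔽),
      IsUnit N ∧ IsUnit M ∧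
      (C : Set (Matrix (Fin n) (Fin m) 𝔽)) =
        (fun A : Matrix (Fin n) (Fin m) 𝔽 =>
          N * (Matrix.reindex (finCongr h.symm) (finCongr h) Aᵀ) * M) ''
          (D : Set (Matrix (Fin n) (Fin m) 𝔽)))

/-- The Gaussian `q`-binomial coefficient, as a rational number. -/
def gaussBinom (q a r : ℕ) : ℚ :=
  (∏ i ∈ Finset.range r, ((q : ℚ) ^ a - (q : ℚ) ^ i)) /
    (∏ i ∈ Finset.range r, ((q : ℚ) ^ r - (q : ℚ) ^ i))

/-- `φ_q(a, b, r)`: the number of rank-`r` matrices in `𝔽_q^{a×b}`. -/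
def phiq (q a b r : ℕ) : ℚ :=
  gaussBinom q a r * ∏ i ∈ Finset.range r, ((q : ℚ) ^ b - (q : ℚ) ^ i)

theorem mem_spanFirst {𝔽 : Type*} [Field 𝔽] {ℓ s : ℕ} {v : Fin ℓ → 𝔽} :
    v ∈ spanFirst 𝔽 ℓ s ↔ ∀ i : Fin ℓ, s ≤ i → v i = 0 := by
  have h := Pi.mem_spanSubset_iff (s := {i : Fin ℓ | (i : ℕ) < s}) (v := v)
  simpa [spanFirst, Pi.spanSubset, Set.image] using h

theorem finrank_submodulePi {𝔽 ι E : Type*} [Field 𝔽] [Fintype ι] [AddCommGroup E] [Module 𝔽 E]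
    [FiniteDimensional 𝔽 E] (W : ι → Submodule 𝔽 E) :
    Module.finrank 𝔽 (Submodule.pi Set.univ W) = ∑ i, Module.finrank 𝔽 (W i) := by
  rw [← Module.finrank_pi_fintype]
  exact LinearEquiv.finrank_eq
    { toFun := fun x i => ⟨x.1 i, x.2 i trivial⟩
      invFun := fun y => ⟨fun i => y i, fun i _ => (y i).2⟩
      map_add' := fun _ _ => rfl
      map_smul' := fun _ _ => rfl
      left_inv := fun _ => rfl
      right_inv := fun _ => rfl }

/-- The submodule of `E^n` with first `s` entries in `A`, next `h` entries in `B`, and zero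
entries afterwards. -/
def layered {𝔽 E : Type*} [Field 𝔽] [AddCommGroup E] [Module 𝔽 E] (n s h : ℕ)
    (A B : Submodule 𝔽 E) : Submodule 𝔽 (Fin n → E) :=
  Submodule.pi Set.univ fun i : Fin n =>
    if (i : ℕ) < s then A else if (i : ℕ) < s + h then B else ⊥

theorem finrank_layered {𝔽 E : Type*} [Field 𝔽] [AddCommGroup E] [Module 𝔽 E]
    [FiniteDimensional 𝔽 E] {n s h : ℕ} (hn : s + h ≤ n) (A B : Submodule 𝔽 E) :
    Module.finrank 𝔽 (layered n s h A B) =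
      s * Module.finrank 𝔽 A + h * Module.finrank 𝔽 B := by
  obtain ⟨r, rfl⟩ := Nat.exists_eq_add_of_le hn
  have first : ∀ x : Fin s, Module.finrank 𝔽 ↥(if (x : ℕ) < s then A
      else if (x : ℕ) < s + h then B else ⊥) = Module.finrank 𝔽 A := fun x => by
    rw [if_pos x.2]
  have second : ∀ x : Fin h, Module.finrank 𝔽 ↥(if s + (x : ℕ) < s then A
      else if s + (x : ℕ) < s + h then B else ⊥) = Module.finrank 𝔽 B := fun x => by
    rw [if_neg (by omega), if_pos (by omega)]
  have third : ∀ x : Fin r, Module.finrank 𝔽 ↥(if s + h + (x : ℕ) < s then A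
      else if s + h + (x : ℕ) < s + h then B else ⊥) = 0 := fun x => by
    rw [if_neg (by omega), if_neg (by omega), finrank_bot]
  rw [layered, finrank_submodulePi, Fin.sum_univ_add, Fin.sum_univ_add]
  simp only [Fin.val_castAdd, Fin.val_natAdd, first, second, third]
  simp

theorem finrank_spanFirst {𝔽 : Type*} [Field 𝔽] {ℓ k : ℕ} (hk : k ≤ ℓ) :
    Module.finrank 𝔽 (spanFirst 𝔽 ℓ k) = k := by
  have h : spanFirst 𝔽 ℓ k = layered ℓ k 0 ⊤ ⊥ := by
    ext v
    rw [mem_spanFirst, layered, Submodule.mem_pi]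
    refine forall_congr' fun i => ?_
    by_cases hi : (i : ℕ) < k
    · simp [hi]
    · simp [hi, Nat.not_lt.1 hi]
  rw [h, finrank_layered (by omega)]
  simp

theorem finrank_add_finrank_perp {𝔽 : Type*} [Field 𝔽] {ℓ : ℕ}
    (K : Submodule 𝔽 (Fin ℓ → 𝔽)) :
    Module.finrank 𝔽 K + Module.finrank 𝔽 (perp K) = ℓ := by
  have h : perp K =
      K.dualAnnihilator.comap (dotProductEquiv 𝔽 (Fin ℓ)).toLinearMap := by
    ext v
    simp [perp, Submodule.mem_dualAnnihilator, dotProduct]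
  rw [h, Submodule.comap_equiv_eq_map_symm, LinearEquiv.finrank_map_eq,
    Subspace.finrank_add_finrank_dualAnnihilator_eq, Module.finrank_fin_fun]

theorem matCol_sup_matRow_inf_matCol {𝔽 : Type*} [Field 𝔽] {n m s h : ℕ}
    (U : Submodule 𝔽 (Fin m → 𝔽)) :
    matCol (spanFirst 𝔽 n s) ⊔ (matRow U ⊓ matCol (spanFirst 𝔽 n (s + h))) =
      layered n s h ⊤ U := by
  have memCol : ∀ (t : ℕ) (M : Matrix (Fin n) (Fin m) 𝔽),
      M ∈ matCol (spanFirst 𝔽 n t) ↔ ∀ i : Fin n, t ≤ i → M i = 0 := by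
    intro t M
    change (∀ j, (fun i => M i j) ∈ spanFirst 𝔽 n t) ↔ _
    simp only [mem_spanFirst, funext_iff, Pi.zero_apply]
    exact ⟨fun H i hi j => H j i hi, fun H j i hi => H i hi j⟩
  have memRow : ∀ M : Matrix (Fin n) (Fin m) 𝔽, M ∈ matRow U ↔ ∀ i, M i ∈ U :=
    fun _ => Iff.rfl
  apply le_antisymm
  · refine sup_le ?_ ?_
    · intro M hM i _
      have := (memCol _ _).1 hM i
      dsimp only
      split_ifs with h1 h2
      · trivial
      · rw [this (by omega)]
        exact U.zero_mem
      · exact this (by omega)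
    · rintro M ⟨hU, hM⟩ i _
      have := (memCol _ _).1 hM i
      dsimp only
      split_ifs with h1 h2
      · trivial
      · exact hU i
      · exact this (by omega)
  · intro M hM
    have hM : ∀ i : Fin n, M i ∈
        (if (i : ℕ) < s then ⊤ else if (i : ℕ) < s + h then U else ⊥ :
          Submodule 𝔽 (Fin m → 𝔽)) := fun i => hM i trivial
    refine Submodule.mem_sup.2
      ⟨Matrix.of fun i => if (i : ℕ) < s then M i else 0, (memCol _ _).2 fun i hi => ?_,
        Matrix.of fun i => if (i : ℕ) < s then 0 else M i,
        ⟨(memRow _).2 fun i => ?_, (memCol _ _).2 fun i hi => ?_⟩, ?_⟩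
    · funext j
      simp [Nat.not_lt.2 hi]
    · have := hM i
      change (if (i : ℕ) < s then 0 else M i) ∈ U
      split_ifs at this ⊢ with h1 h2
      · exact U.zero_mem
      · exact this
      · rw [(Submodule.mem_bot 𝔽).1 this]
        exact U.zero_mem
    · have := hM i
      rw [if_neg (by omega), if_neg (by omega)] at this
      change (if (i : ℕ) < s then 0 else M i) = 0
      rw [if_neg (by omega)]
      exact this
    · funext i
      change (if (i : ℕ) < s then M i else 0) + (if (i : ℕ) < s then 0 else M i) = M i
      split_ifs <;> simp

theorem layered_inf_matRow {𝔽 : Type*} [Field 𝔽] {n m s h : ℕ}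
    (A B P : Submodule 𝔽 (Fin m → 𝔽)) :
    (layered n s h A B ⊓ matRow P : Submodule 𝔽 (Matrix (Fin n) (Fin m) 𝔽)) =
      layered n s h (A ⊓ P) (B ⊓ P) := by
  have key : ∀ i : Fin n,
      (if (i : ℕ) < s then A ⊓ P else if (i : ℕ) < s + h then B ⊓ P else ⊥) =
        (if (i : ℕ) < s then A else if (i : ℕ) < s + h then B else ⊥) ⊓ P := by
    intro i
    split_ifs <;> simp
  ext M
  simp only [layered, key]
  exact ⟨fun H i hi => ⟨H.1 i hi, H.2 i⟩,
    fun H => ⟨fun i hi => (H i hi).1, fun i => (H i trivial).2⟩⟩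

/-- Row rank function of the `q`-polymatroid associated to
`C = Mat(V) + (Mat(U)ᵗ ∩ Mat(V'))`. -/
theorem stmt15 {𝔽 : Type*} [Field 𝔽] [Fintype 𝔽] {n m s h k : ℕ}
    (hn : 1 ≤ n) (hnm : n ≤ m) (hkm : k ≤ m) (hs : s ≤ m - h) (hshn : s + h ≤ n)
    (C : Submodule 𝔽 (Matrix (Fin n) (Fin m) 𝔽))
    (hC : C = matCol (spanFirst 𝔽 n s) ⊔
        (matRow (spanFirst 𝔽 m k) ⊓ matCol (spanFirst 𝔽 n (s + h))))
    (K : Submodule 𝔽 (Fin m → 𝔽)) :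
    Module.finrank 𝔽 C - Module.finrank 𝔽 ↥(C ⊓ matRow (perp K)) =
        h * (k - Module.finrank 𝔽 ↥(spanFirst 𝔽 m k ⊓ perp K)) +
          s * Module.finrank 𝔽 K ∧
    ((Module.finrank 𝔽 C : ℚ) -
        (Module.finrank 𝔽 ↥(C ⊓ matRow (perp K)) : ℚ)) / (n : ℚ) =
      ((h : ℚ) * ((k : ℚ) - (Module.finrank 𝔽 ↥(spanFirst 𝔽 m k ⊓ perp K) : ℚ)) +
        (s : ℚ) * (Module.finrank 𝔽 K : ℚ)) / (n : ℚ) := by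
  have hd : Module.finrank 𝔽 C = s * m + h * k := by
    rw [hC, matCol_sup_matRow_inf_matCol]
    exact (finrank_layered hshn _ _).trans (by simp [finrank_spanFirst hkm])
  have hdP : Module.finrank 𝔽 ↥(C ⊓ matRow (perp K)) =
      s * Module.finrank 𝔽 (perp K) +
        h * Module.finrank 𝔽 ↥(spanFirst 𝔽 m k ⊓ perp K) := by
    rw [hC, matCol_sup_matRow_inf_matCol, layered_inf_matRow, top_inf_eq]
    exact finrank_layered hshn _ _
  have hperp := finrank_add_finrank_perp K
  have hle : Module.finrank 𝔽 ↥(spanFirst 𝔽 m k ⊓ perp K) ≤ k :=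
    (Submodule.finrank_mono inf_le_left).trans_eq (finrank_spanFirst hkm)
  rw [hd, hdP]
  generalize Module.finrank 𝔽 ↥(spanFirst 𝔽 m k ⊓ perp K) = u at *
  generalize Module.finrank 𝔽 K = d at *
  generalize Module.finrank 𝔽 (perp K) = p at *
  obtain ⟨c, rfl⟩ := Nat.exists_eq_add_of_le hle
  subst hperp
  constructor
  · rw [Nat.add_sub_cancel_left]
    apply Nat.sub_eq_of_eq_add
    ring
  · congr 1
    push_cast
    ring
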